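/- arXiv:1706.07483 — 4 statements merged into one kernel-verified Lean document; each statement's English description precedes it below -/
import Mathlib

section
/- Let z1, z2, z3 : ℝ → ℝ be differentiable functions and ω : ℝ → ℝ any function such that for all t: z1'(t) = z3(t), z2'(t) = −ω(t)² z3(t), and z3'(t) = −2ω(t)² z1(t) + 2 z2(t). Then the Casimir companion t ↦ z1(t) z2(t) − z3(t)²/4 is constant in t. -/
/-- The Casimir companion `z1 z2 - z3^2/4` is a constant of the motion for the
system `z1' = z3`, `z2' = -ω² z3`, `z3' = -2ω² z1 + 2 z2`. -/
theorem casimir_companion_constant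
    (z1 z2 z3 ω : ℝ → ℝ)
    (hz1 : Differentiable ℝ z1) (hz2 : Differentiable ℝ z2)
    (hz3 : Differentiable ℝ z3)
    (hd1 : ∀ t, deriv z1 t = z3 t)
    (hd2 : ∀ t, deriv z2 t = -(ω t) ^ 2 * z3 t)
    (hd3 : ∀ t, deriv z3 t = -2 * (ω t) ^ 2 * z1 t + 2 * z2 t) :
    ∀ t t' : ℝ,
      z1 t * z2 t - (z3 t) ^ 2 / 4 = z1 t' * z2 t' - (z3 t') ^ 2 / 4 := by
  have key (t : ℝ) : HasDerivAt (fun s => z1 s * z2 s - (z3 s) ^ 2 / 4) 0 t := by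
    have h1 := (hz1 t).hasDerivAt
    have h2 := (hz2 t).hasDerivAt
    have h3 := (hz3 t).hasDerivAt
    rw [hd1] at h1
    rw [hd2] at h2
    rw [hd3] at h3
    refine ((h1.fun_mul h2).fun_sub ((h3.fun_pow 2).div_const 4)).congr_deriv ?_
    push_cast
    ring
  exact is_const_of_deriv_eq_zero (fun t => (key t).differentiableAt) fun t => (key t).deriv
end

section
/- Let γ > 1. Then the function l₊(s) = (c + √(c² − 4(s + u₂)))/(c₁ + √(c₁² − 4(s + u₁))) is strictly increasing on the interval [0, s_m], where u₁ = 1/γ⁴, u₂ = 1, c₁ = u₁ + 1, c = γ² + 1/γ², s_m = (1 − u₁)²/4. -/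
/-- If `a < p` and `0 < D ≤ C`, then `s ↦ (C + √(p - s)) / (D + √(a - s))` is strictly increasing
for `s ≤ a`. -/
theorem strictMonoOn_add_sqrt_div_add_sqrt {a p C D : ℝ} (hap : a < p) (hD : 0 < D)
    (hDC : D ≤ C) :
    StrictMonoOn (fun s : ℝ => (C + √(p - s)) / (D + √(a - s))) (Set.Iic a) := by
  intro s hs t ht hst
  rw [Set.mem_Iic] at hs ht
  have sq_ps : √(p - s) ^ 2 = p - s := Real.sq_sqrt (by linarith)
  have sq_pt : √(p - t) ^ 2 = p - t := Real.sq_sqrt (by linarith)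
  have sq_as : √(a - s) ^ 2 = a - s := Real.sq_sqrt (by linarith)
  have sq_at : √(a - t) ^ 2 = a - t := Real.sq_sqrt (by linarith)
  have lt_s : √(a - s) < √(p - s) := Real.sqrt_lt_sqrt (by linarith) (by linarith)
  have lt_t : √(a - t) < √(p - t) := Real.sqrt_lt_sqrt (by linarith) (by linarith)
  have lt_a : √(a - t) < √(a - s) := Real.sqrt_lt_sqrt (by linarith) (by linarith)
  have cross : √(p - s) * √(a - t) ≤ √(p - t) * √(a - s) := by
    rw [← Real.sqrt_mul (by linarith), ← Real.sqrt_mul (by linarith)]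
    apply Real.sqrt_le_sqrt
    nlinarith [mul_pos (sub_pos.2 hap) (sub_pos.2 hst)]
  have nonneg_at := Real.sqrt_nonneg (a - t)
  change _ / _ < _ / _
  rw [div_lt_div_iff₀ (by positivity) (by positivity)]
  generalize √(p - s) = x at *
  generalize √(p - t) = y at *
  generalize √(a - s) = z at *
  generalize √(a - t) = w at *
  have diff : x - y < z - w := by
    by_contra! h
    have := mul_le_mul_of_nonneg_right h (by linarith : 0 ≤ x + y)
    nlinarith [mul_pos (sub_pos.2 lt_a) (by linarith : 0 < x + y - (z + w))]
  nlinarith [mul_lt_mul_of_pos_left diff hD,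
    mul_nonneg (sub_nonneg.2 hDC) (sub_pos.2 lt_a).le]

/-- `l₊(s) = (c + √(c² - 4(s + u₂)))/(c₁ + √(c₁² - 4(s + u₁)))` is strictly
increasing on `[0, s_m]`, with `u₁ = 1/γ⁴`, `u₂ = 1`, `c₁ = u₁ + 1`,
`c = γ² + 1/γ²`, `s_m = (1 - u₁)²/4`. -/
theorem l_plus_strictMonoOn (γ : ℝ) (hγ : 1 < γ) :
    StrictMonoOn
      (fun s : ℝ =>
        ((γ ^ 2 + 1 / γ ^ 2) +
              Real.sqrt ((γ ^ 2 + 1 / γ ^ 2) ^ 2 - 4 * (s + 1))) /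
          ((1 / γ ^ 4 + 1) +
              Real.sqrt ((1 / γ ^ 4 + 1) ^ 2 - 4 * (s + 1 / γ ^ 4))))
      (Set.Icc 0 ((1 - 1 / γ ^ 4) ^ 2 / 4)) := by
  have one_lt_sq : 1 < γ ^ 2 := one_lt_pow₀ hγ two_ne_zero
  have inv_lt : 1 / γ ^ 4 < 1 := by
    rw [div_lt_one (by positivity)]
    exact one_lt_pow₀ hγ four_ne_zero
  have inv_pos : 0 < 1 / γ ^ 4 := by positivity
  have scale : γ ^ 2 + 1 / γ ^ 2 = γ ^ 2 * (1 / γ ^ 4 + 1) := by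
    field_simp
    ring
  have unit : γ ^ 4 * (1 / γ ^ 4) = 1 := by field_simp
  rw [scale]
  generalize 1 / γ ^ 4 = u at *
  have radicand : (γ ^ 2 * (u + 1)) ^ 2 - 4 = γ ^ 4 * (1 - u) ^ 2 := by
    linear_combination 4 * unit
  have one_lt : 1 < γ ^ 4 := one_lt_pow₀ hγ four_ne_zero
  have lt_radicand : (1 - u) ^ 2 < (γ ^ 2 * (u + 1)) ^ 2 - 4 := by
    rw [radicand]
    exact lt_mul_of_one_lt_left (pow_pos (sub_pos.2 inv_lt) 2) one_lt
  intro s hs t ht hst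
  have mono := strictMonoOn_add_sqrt_div_add_sqrt lt_radicand (by linarith : 0 < u + 1)
    (le_mul_of_one_le_left (by linarith) one_lt_sq.le)
  have key := mono (a := 4 * s) (b := 4 * t) (Set.mem_Iic.2 (by linarith [hs.2]))
    (Set.mem_Iic.2 (by linarith [ht.2])) (by linarith)
  convert key using 4 <;> ring_nf
end

section
/- For γ > 1 let s(γ) = (c₁u₂ − c u₁)/(c − c₁) − ((u₂ − u₁)/(c − c₁))², and define τ₁⁺(γ) = τᵢ⁺(s(γ), γ) + τ_f(s(γ), γ). Then τ₁⁺(γ)/γ → 1 as γ → ∞, i.e. the duration of the one-switching extremal grows asymptotically like γ = √(ω_h/ω_c). -/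
open Filter

/-- `u₁ = 1/γ⁴`. -/
noncomputable def u1 (γ : ℝ) : ℝ := 1 / γ ^ 4

/-- `u₂ = 1`. -/
noncomputable def u2 : ℝ := 1

/-- `c₁ = u₁ + 1`. -/
noncomputable def c1 (γ : ℝ) : ℝ := u1 γ + 1

/-- `c = γ² + 1/γ²`. -/
noncomputable def cConst (γ : ℝ) : ℝ := γ ^ 2 + 1 / γ ^ 2

/-- Duration `τᵢ⁺(s, γ)` of the initial segment. -/
noncomputable def tauIPlus (s γ : ℝ) : ℝ :=
  1 / (2 * Real.sqrt (u1 γ)) *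
    Real.arccos
      ((s * c1 γ - u1 γ * Real.sqrt ((c1 γ) ^ 2 - 4 * (s + u1 γ))) /
        ((s + u1 γ) * Real.sqrt ((c1 γ) ^ 2 - 4 * u1 γ)))

/-- Duration `τ_f(s, γ)` of the final segment. -/
noncomputable def tauF (s γ : ℝ) : ℝ :=
  1 / (2 * Real.sqrt u2) *
    Real.arccos
      ((-(s * cConst γ) + u2 * Real.sqrt ((cConst γ) ^ 2 - 4 * (s + u2))) /
        ((s + u2) * Real.sqrt ((cConst γ) ^ 2 - 4 * u2)))

/-- Squared slope ratio of the one-switching extremal. -/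
noncomputable def sOne (γ : ℝ) : ℝ :=
  (c1 γ * u2 - cConst γ * u1 γ) / (cConst γ - c1 γ) -
    ((u2 - u1 γ) / (cConst γ - c1 γ)) ^ 2

/-- `s(γ) = x * scaledSlope x` for `x = 1/γ²`. -/
noncomputable def scaledSlope (x : ℝ) : ℝ := 1 - x * (1 + x) ^ 2 / (1 + x ^ 2) ^ 2

/-- The argument of the arccosine in `τᵢ⁺(s(γ), γ)` is `1 - x * cosDefect x` for `x = 1/γ²`. -/
noncomputable def cosDefect (x : ℝ) : ℝ :=
  (1 - x ^ 2 - 2 * x * scaledSlope x +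
      Real.sqrt ((1 + x ^ 2) ^ 2 - 4 * (x * scaledSlope x + x ^ 2))) /
    ((scaledSlope x + x) * (1 - x ^ 2))

lemma continuous_scaledSlope : Continuous scaledSlope := by
  unfold scaledSlope
  refine continuous_const.sub (Continuous.div (by fun_prop) (by fun_prop) fun x => ?_)
  positivity

lemma scaledSlope_zero : scaledSlope 0 = 1 := by simp [scaledSlope]

lemma cosDefect_zero : cosDefect 0 = 2 := by
  norm_num [cosDefect, scaledSlope_zero]

lemma continuousAt_cosDefect : ContinuousAt cosDefect 0 := by
  have h := continuous_scaledSlope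
  unfold cosDefect
  refine ContinuousAt.div (by fun_prop) (by fun_prop) ?_
  simp [scaledSlope_zero]

lemma scaledSlope_add_pos {x : ℝ} (hx : 0 < x) : 0 < scaledSlope x + x := by
  have h : scaledSlope x + x = (1 + x ^ 3 + x ^ 4 + x ^ 5) / (1 + x ^ 2) ^ 2 := by
    unfold scaledSlope
    field_simp
    ring
  rw [h]
  positivity

lemma sOne_eq {γ : ℝ} (hγ : 1 < γ) : sOne γ = (γ⁻¹) ^ 2 * scaledSlope ((γ⁻¹) ^ 2) := by
  obtain ⟨x, hx⟩ : ∃ x, x = (γ⁻¹) ^ 2 := ⟨_, rfl⟩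
  have hγ0 : 0 < γ := by linarith
  have hx0 : 0 < x := by rw [hx]; positivity
  have hx1 : x < 1 := by
    rw [hx]; exact pow_lt_one₀ (by positivity) (inv_lt_one_of_one_lt₀ hγ) (by norm_num)
  have hu : u1 γ = x ^ 2 := by rw [hx, u1]; field_simp
  have hc : cConst γ = 1 / x + x := by rw [hx, cConst]; field_simp
  have h1x : (1 - x) ≠ 0 := by linarith
  have hd : 1 / x + x - (x ^ 2 + 1) = (1 - x) * (1 + x ^ 2) / x := by field_simp; ring
  rw [← hx, sOne, c1, hu, hc, hd, u2, scaledSlope]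
  field_simp
  ring

lemma tauIPlus_sOne_eq {γ : ℝ} (hγ : 1 < γ) :
    tauIPlus (sOne γ) γ =
      γ ^ 2 / 2 * Real.arccos (1 - (γ⁻¹) ^ 2 * cosDefect ((γ⁻¹) ^ 2)) := by
  rw [sOne_eq hγ]
  obtain ⟨x, hx⟩ : ∃ x, x = (γ⁻¹) ^ 2 := ⟨_, rfl⟩
  have hγ0 : 0 < γ := by linarith
  have hx0 : 0 < x := by rw [hx]; positivity
  have hx1 : x < 1 := by
    rw [hx]; exact pow_lt_one₀ (by positivity) (inv_lt_one_of_one_lt₀ hγ) (by norm_num)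
  have hu : u1 γ = x ^ 2 := by rw [hx, u1]; field_simp
  have hg : γ ^ 2 = 1 / x := by rw [hx]; field_simp
  have hx2 : 0 < 1 - x ^ 2 := by nlinarith
  have hroot : Real.sqrt ((x ^ 2 + 1) ^ 2 - 4 * x ^ 2) = 1 - x ^ 2 := by
    rw [show (x ^ 2 + 1) ^ 2 - 4 * x ^ 2 = (1 - x ^ 2) ^ 2 by ring, Real.sqrt_sq hx2.le]
  have hpos := scaledSlope_add_pos hx0
  rw [← hx, hg, tauIPlus, c1, hu, hroot, Real.sqrt_sq hx0.le, cosDefect, add_comm (x ^ 2) 1]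
  generalize Real.sqrt _ = r
  generalize scaledSlope x = σ at hpos ⊢
  congr 1
  · field_simp
  · congr 1
    rw [show x * σ + x ^ 2 = x * (σ + x) by ring]
    field_simp
    ring

/-- If `k` is continuous at `0`, then `arccos (1 - t² k(t)) ~ t √(2 k(0))` as `t → 0⁺`. -/
lemma tendsto_arccos_one_sub_sq_mul_div {k : ℝ → ℝ} (hk : ContinuousAt k 0) :
    Tendsto (fun t => Real.arccos (1 - t ^ 2 * k t) / t) (nhdsWithin 0 (Set.Ioi 0))
      (nhds (Real.sqrt (2 * k 0))) := by
  let g : ℝ → ℝ := fun t => Real.sqrt (k t * (2 - t ^ 2 * k t))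
  have hg : ContinuousAt g 0 := by fun_prop
  have hg0 : g 0 = Real.sqrt (2 * k 0) := by simp [g, mul_comm]
  have hmul : HasDerivAt (fun t => t * g t) (g 0) 0 := by
    rw [hasDerivAt_iff_tendsto_slope]
    refine (hg.tendsto.mono_left nhdsWithin_le_nhds).congr' ?_
    filter_upwards [self_mem_nhdsWithin] with t ht
    have ht : t ≠ 0 := ht
    simp [slope_def_field, ht]
  have harcsin : HasDerivAt Real.arcsin 1 (0 * g 0) := by
    simpa using Real.hasDerivAt_arcsin (x := 0) (by norm_num) (by norm_num)
  have hcomp := (harcsin.comp (0 : ℝ) hmul).tendsto_slope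
  rw [one_mul, hg0] at hcomp
  refine (hcomp.mono_left (nhdsWithin_mono _ fun t (ht : 0 < t) => ht.ne')).congr' ?_
  have hle : ∀ᶠ t in nhds (0 : ℝ), t ^ 2 * k t < 1 := by
    have : ContinuousAt (fun t : ℝ => t ^ 2 * k t) 0 := by fun_prop
    exact this.eventually_lt continuousAt_const (by simp)
  filter_upwards [self_mem_nhdsWithin, nhdsWithin_le_nhds hle] with t ht h1
  have ht : 0 < t := ht
  rw [Real.arccos_eq_arcsin (by linarith),
    show 1 - (1 - t ^ 2 * k t) ^ 2 = t ^ 2 * (k t * (2 - t ^ 2 * k t)) by ring,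
    Real.sqrt_mul (sq_nonneg t), Real.sqrt_sq ht.le]
  simp [slope_def_field, g]

lemma tendsto_tauIPlus_sOne_div :
    Tendsto (fun γ : ℝ => tauIPlus (sOne γ) γ / γ) atTop (nhds 1) := by
  have hk : ContinuousAt (fun t : ℝ => cosDefect (t ^ 2)) 0 := by
    refine ContinuousAt.comp (g := cosDefect) ?_ (by fun_prop)
    simpa using continuousAt_cosDefect
  have h := ((tendsto_arccos_one_sub_sq_mul_div hk).comp
    (tendsto_inv_atTop_nhdsGT_zero (𝕜 := ℝ))).div_const 2
  have hlim : Real.sqrt (2 * cosDefect (0 ^ 2)) / 2 = 1 := by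
    rw [zero_pow two_ne_zero, cosDefect_zero, Real.sqrt_mul_self zero_le_two]
    norm_num
  rw [hlim] at h
  refine h.congr' ?_
  filter_upwards [eventually_gt_atTop 1] with γ hγ
  have hγ0 : γ ≠ 0 := by linarith
  rw [tauIPlus_sOne_eq hγ, Function.comp_apply]
  field_simp

lemma tendsto_tauF_div (s : ℝ → ℝ) :
    Tendsto (fun γ : ℝ => tauF (s γ) γ / γ) atTop (nhds 0) := by
  refine tendsto_of_tendsto_of_tendsto_of_le_of_le' tendsto_const_nhds
    ((tendsto_const_nhds (x := Real.pi)).div_atTop tendsto_id) ?_ ?_ <;>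
    filter_upwards [eventually_gt_atTop 0] with γ hγ
  · exact div_nonneg (mul_nonneg (by positivity) (Real.arccos_nonneg _)) hγ.le
  · refine div_le_div_of_nonneg_right ?_ hγ.le
    rw [tauF, u2, Real.sqrt_one]
    nlinarith [Real.arccos_le_pi ((-(s γ * cConst γ) + 1 * Real.sqrt ((cConst γ) ^ 2 -
      4 * (s γ + 1))) / ((s γ + 1) * Real.sqrt ((cConst γ) ^ 2 - 4 * 1))), Real.pi_pos]

/-- The duration `τ₁⁺(γ) = τᵢ⁺(s(γ), γ) + τ_f(s(γ), γ)` of the one-switching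
extremal satisfies `τ₁⁺(γ)/γ → 1` as `γ → ∞`. -/
theorem one_switching_time_asymptotics :
    Tendsto (fun γ : ℝ => (tauIPlus (sOne γ) γ + tauF (sOne γ) γ) / γ)
      atTop (nhds 1) := by
  simpa [add_div] using tendsto_tauIPlus_sOne_div.add (tendsto_tauF_div sOne)
end

section
/- Let s : (1, ∞) → ℝ satisfy 0 < s(γ) ≤ s_m for all γ > 1 and s(γ) → 1/4 as γ → ∞. Then, as γ → ∞: (i) τᵢ⁺(s(γ), γ) → 1; (ii) τ_{u₁}(s(γ), γ) → 2; (iii) τ_{u₂}(s(γ), γ) → (π + arccos(3/5))/2; (iv) τ_f(s(γ), γ) → (1/2) arccos(3/5). -/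
open Filter

/-- `s_m = (1 - u₁)²/4`. -/
noncomputable def sm (γ : ℝ) : ℝ := (1 - u1 γ) ^ 2 / 4

/-- Duration `τ_{u₁}(s, γ)` of each intermediate segment with control `u₁`. -/
noncomputable def tauU1 (s γ : ℝ) : ℝ :=
  1 / (2 * Real.sqrt (u1 γ)) * Real.arccos ((s - u1 γ) / (s + u1 γ))

/-- Duration `τ_{u₂}(s, γ)` of each intermediate segment with control `u₂`. -/
noncomputable def tauU2 (s γ : ℝ) : ℝ :=
  1 / (2 * Real.sqrt u2) * (2 * Real.pi - Real.arccos ((s - u2) / (s + u2)))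

open Topology

/-- Half-angle form of `arccos` near `1`. -/
lemma arccos_one_sub_two_mul_sq {t : ℝ} (h0 : 0 ≤ t) (h1 : t ≤ 1) :
    Real.arccos (1 - 2 * t ^ 2) = 2 * Real.arcsin t := by
  have hcos : Real.cos (2 * Real.arcsin t) = 1 - 2 * t ^ 2 := by
    rw [Real.cos_two_mul, Real.cos_sq', Real.sin_arcsin (by linarith) h1]
    ring
  rw [← hcos, Real.arccos_cos]
  · linarith [Real.arcsin_nonneg.2 h0]
  · linarith [Real.arcsin_le_pi_div_two t]

/-- First-order asymptotics of `arccos` at `1`: if `u → 0⁺` and `k → K > 0`, then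
`arccos (1 - u k) / (2 √u) → √(K / 2)`. -/
lemma tendsto_arccos_one_sub_mul_div {ι : Type*} {l : Filter ι} {u k : ι → ℝ} {K : ℝ} (hK : 0 < K)
    (hu : Tendsto u l (𝓝 0)) (hupos : ∀ᶠ x in l, 0 < u x) (hk : Tendsto k l (𝓝 K)) :
    Tendsto (fun x => 1 / (2 * √(u x)) * Real.arccos (1 - u x * k x)) l (𝓝 √(K / 2)) := by
  have hsqrt : Tendsto (fun x => √(k x / 2)) l (𝓝 √(K / 2)) := (hk.div_const 2).sqrt
  have ht : Tendsto (fun x => √(u x) * √(k x / 2)) l (𝓝 0) := by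
    simpa using hu.sqrt.mul hsqrt
  have hderiv : HasDerivAt Real.arcsin 1 0 := by
    simpa using Real.hasDerivAt_arcsin (x := 0) (by norm_num) (by norm_num)
  have hslope : Tendsto (dslope Real.arcsin 0) (𝓝 0) (𝓝 1) := by
    have h := (continuousAt_dslope_same.2 hderiv.differentiableAt).tendsto
    rwa [dslope_same, hderiv.deriv] at h
  have hprod := (hslope.comp ht).mul hsqrt
  rw [one_mul] at hprod
  refine hprod.congr' ?_
  filter_upwards [hupos, hk.eventually (lt_mem_nhds hK), ht.eventually (gt_mem_nhds zero_lt_one)]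
    with x hux hkx htx
  have hsq : (√(u x) * √(k x / 2)) ^ 2 = u x * (k x / 2) := by
    rw [mul_pow, Real.sq_sqrt hux.le, Real.sq_sqrt (by positivity)]
  have harccos : Real.arccos (1 - u x * k x) = 2 * Real.arcsin (√(u x) * √(k x / 2)) := by
    rw [← arccos_one_sub_two_mul_sq (by positivity) htx.le, hsq]
    congr 1
    ring
  have hds : Real.arcsin (√(u x) * √(k x / 2)) =
      √(u x) * √(k x / 2) * dslope Real.arcsin 0 (√(u x) * √(k x / 2)) := by
    simpa using (sub_smul_dslope Real.arcsin 0 (√(u x) * √(k x / 2))).symm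
  have hpos : 0 < √(u x) := Real.sqrt_pos.2 hux
  rw [harccos, hds, Function.comp_apply]
  field_simp

lemma tendsto_u1 : Tendsto u1 atTop (𝓝 0) :=
  (tendsto_const_nhds (x := (1 : ℝ))).div_atTop (tendsto_pow_atTop (n := 4) (by norm_num))

lemma u1_pos {γ : ℝ} (h : 1 < γ) : 0 < u1 γ := by
  unfold u1
  positivity

lemma u1_lt_one {γ : ℝ} (h : 1 < γ) : u1 γ < 1 := by
  unfold u1
  rw [div_lt_one (by positivity)]
  exact one_lt_pow₀ h (by norm_num)

lemma cConst_pos {γ : ℝ} (h : 1 < γ) : 0 < cConst γ := by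
  unfold cConst
  positivity

lemma tendsto_cConst : Tendsto cConst atTop atTop := by
  refine tendsto_atTop_mono (fun γ => ?_) (tendsto_pow_atTop (α := ℝ) (n := 2) (by norm_num))
  unfold cConst
  have : 0 ≤ 1 / γ ^ 2 := by positivity
  linarith

lemma sqrt_sq_sub_eq_mul {c : ℝ} (hc : 0 < c) (a : ℝ) : √(c ^ 2 - a) = c * √(1 - a / c ^ 2) := by
  have h : c ^ 2 - a = c ^ 2 * (1 - a / c ^ 2) := by field_simp
  rw [h, Real.sqrt_mul (sq_nonneg c), Real.sqrt_sq hc.le]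

section Limits

variable {s : ℝ → ℝ}

lemma tendsto_tauIPlus (hs : ∀ᶠ γ in atTop, 0 < s γ) (hlim : Tendsto s atTop (𝓝 (1 / 4))) :
    Tendsto (fun γ => tauIPlus (s γ) γ) atTop (𝓝 1) := by
  have hR : Tendsto (fun γ => √(c1 γ ^ 2 - 4 * (s γ + u1 γ))) atTop (𝓝 0) := by
    have h := ((((tendsto_u1.add_const 1).pow 2).sub ((hlim.add tendsto_u1).const_mul 4))).sqrt
    norm_num at h
    exact h
  have hk : Tendsto (fun γ => (1 - u1 γ - 2 * s γ + √(c1 γ ^ 2 - 4 * (s γ + u1 γ))) /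
      ((s γ + u1 γ) * (1 - u1 γ))) atTop (𝓝 2) := by
    have h := (((tendsto_u1.const_sub 1).sub (hlim.const_mul 2)).add hR).div
      ((hlim.add tendsto_u1).mul (tendsto_u1.const_sub 1)) (by norm_num)
    norm_num at h
    exact h
  have h := tendsto_arccos_one_sub_mul_div two_pos tendsto_u1
    ((eventually_gt_atTop 1).mono fun _ => u1_pos) hk
  rw [div_self two_ne_zero, Real.sqrt_one] at h
  refine h.congr' ?_
  filter_upwards [eventually_gt_atTop 1, hs] with γ hγ hsγ
  have hu := u1_pos hγ
  have hu' : 0 < 1 - u1 γ := sub_pos.2 (u1_lt_one hγ)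
  have hroot : √(c1 γ ^ 2 - 4 * u1 γ) = 1 - u1 γ := by
    rw [← Real.sqrt_sq hu'.le, c1]
    congr 1
    ring
  rw [tauIPlus, hroot]
  congr 2
  have : s γ + u1 γ ≠ 0 := by positivity
  rw [eq_div_iff (by positivity)]
  field_simp
  rw [show c1 γ = u1 γ + 1 from rfl]
  ring

lemma tendsto_tauU1 (hs : ∀ᶠ γ in atTop, 0 < s γ) (hlim : Tendsto s atTop (𝓝 (1 / 4))) :
    Tendsto (fun γ => tauU1 (s γ) γ) atTop (𝓝 2) := by
  have hk : Tendsto (fun γ => 2 / (s γ + u1 γ)) atTop (𝓝 8) := by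
    have h := (tendsto_const_nhds (x := (2 : ℝ))).div (hlim.add tendsto_u1) (by norm_num)
    norm_num at h
    exact h
  have h := tendsto_arccos_one_sub_mul_div (by norm_num) tendsto_u1
    ((eventually_gt_atTop 1).mono fun _ => u1_pos) hk
  rw [show (8 / 2 : ℝ) = 2 ^ 2 by norm_num, Real.sqrt_sq two_pos.le] at h
  refine h.congr' ?_
  filter_upwards [eventually_gt_atTop 1, hs] with γ hγ hsγ
  have hu := u1_pos hγ
  rw [tauU1]
  congr 2
  field_simp
  ring

lemma tendsto_tauU2 (hlim : Tendsto s atTop (𝓝 (1 / 4))) :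
    Tendsto (fun γ => tauU2 (s γ) γ) atTop (𝓝 ((Real.pi + Real.arccos (3 / 5)) / 2)) := by
  have hq : Tendsto (fun γ => (s γ - u2) / (s γ + u2)) atTop (𝓝 (-(3 / 5))) := by
    have h := (hlim.sub_const u2).div (hlim.add_const u2) (by norm_num [u2])
    norm_num [u2] at h ⊢
    exact h
  have h := (((Real.continuous_arccos.tendsto _).comp hq).const_sub (2 * Real.pi)).const_mul
    (1 / (2 * √u2))
  have hval : 1 / (2 * √u2) * (2 * Real.pi - Real.arccos (-(3 / 5))) =
      (Real.pi + Real.arccos (3 / 5)) / 2 := by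
    rw [Real.arccos_neg, u2, Real.sqrt_one]
    ring
  rwa [hval] at h

lemma tendsto_tauF (hs : ∀ᶠ γ in atTop, 0 < s γ) (hlim : Tendsto s atTop (𝓝 (1 / 4))) :
    Tendsto (fun γ => tauF (s γ) γ) atTop (𝓝 (1 / 2 * Real.arccos (3 / 5))) := by
  have hc : Tendsto (fun γ => cConst γ ^ 2) atTop atTop :=
    (tendsto_pow_atTop two_ne_zero).comp tendsto_cConst
  have hnum : Tendsto (fun γ => √(1 - 4 * (s γ + u2) / cConst γ ^ 2)) atTop (𝓝 1) := by
    simpa using ((((hlim.add_const u2).const_mul 4).div_atTop hc).const_sub 1).sqrt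
  have hden : Tendsto (fun γ => √(1 - 4 * u2 / cConst γ ^ 2)) atTop (𝓝 1) := by
    simpa using (((tendsto_const_nhds (x := 4 * u2)).div_atTop hc).const_sub 1).sqrt
  have hq : Tendsto (fun γ => (-s γ + u2 * √(1 - 4 * (s γ + u2) / cConst γ ^ 2)) /
      ((s γ + u2) * √(1 - 4 * u2 / cConst γ ^ 2))) atTop (𝓝 (3 / 5)) := by
    have h := (hlim.neg.add (hnum.const_mul u2)).div ((hlim.add_const u2).mul hden)
      (by norm_num [u2])
    have hval : (-(1 / 4) + u2 * 1) / ((1 / 4 + u2) * 1) = 3 / 5 := by norm_num [u2]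
    rwa [hval] at h
  have h := ((Real.continuous_arccos.tendsto _).comp hq).const_mul (1 / 2)
  refine h.congr' ?_
  filter_upwards [eventually_gt_atTop 1, hs] with γ hγ hsγ
  have hcpos := cConst_pos hγ
  rw [tauF, sqrt_sq_sub_eq_mul hcpos, sqrt_sq_sub_eq_mul hcpos, Function.comp_apply]
  congr 1
  · simp [u2]
  · rw [← mul_div_mul_left (-s γ + _) _ hcpos.ne']
    congr 2 <;> ring

end Limits

/-- If the switching ratio `s(γ)` satisfies `0 < s(γ) ≤ s_m` and
`s(γ) → 1/4` as `γ → ∞`, then the segment durations satisfy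
`τᵢ⁺ → 1`, `τ_{u₁} → 2`, `τ_{u₂} → (π + arccos(3/5))/2`, and
`τ_f → (1/2)·arccos(3/5)`. -/
theorem segment_duration_limits (s : ℝ → ℝ)
    (hs : ∀ γ : ℝ, 1 < γ → 0 < s γ ∧ s γ ≤ sm γ)
    (hlim : Tendsto s atTop (nhds (1 / 4))) :
    Tendsto (fun γ : ℝ => tauIPlus (s γ) γ) atTop (nhds 1) ∧
      Tendsto (fun γ : ℝ => tauU1 (s γ) γ) atTop (nhds 2) ∧
      Tendsto (fun γ : ℝ => tauU2 (s γ) γ) atTop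
        (nhds ((Real.pi + Real.arccos (3 / 5)) / 2)) ∧
      Tendsto (fun γ : ℝ => tauF (s γ) γ) atTop
        (nhds (1 / 2 * Real.arccos (3 / 5))) := by
  have hpos : ∀ᶠ γ in atTop, 0 < s γ := (eventually_gt_atTop 1).mono fun γ hγ => (hs γ hγ).1
  exact ⟨tendsto_tauIPlus hpos hlim, tendsto_tauU1 hpos hlim, tendsto_tauU2 hlim,
    tendsto_tauF hpos hlim⟩
end
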